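/- If C : {0,1}^n → ({0,1}^ℓ)^m is a (2, c, ε)-smooth code using b bits, then m ≥ 2^{d·n − log₂ u}, where u = Σ_{i=0}^{b} binom(ℓ, i) and d = (1 − H(1/2 + ε/2^{b+1})) · 2^{b+1}/(c·u). -/

import Mathlib

/-- A decoding tuple `(j0, j1, S0, S1, f)` for a 2-query decoder: two query positions,
two sets of answer bits, and an output function (taking the full `ℓ`-bit answers;
the requirement that it only depends on the bits in `S0`/`S1` is `DecTuple.Valid`). -/
structure DecTuple (m ℓ : ℕ) where
  j0 : Fin m
  j1 : Fin m
  S0 : Finset (Fin ℓ)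
  S1 : Finset (Fin ℓ)
  f : (Fin ℓ → Bool) → (Fin ℓ → Bool) → Bool
deriving DecidableEq

/-- Decoding tuples form a finite type. -/
def DecTuple.equivProd (m ℓ : ℕ) :
    (Fin m × Fin m × Finset (Fin ℓ) × Finset (Fin ℓ) ×
      ((Fin ℓ → Bool) → (Fin ℓ → Bool) → Bool)) ≃ DecTuple m ℓ where
  toFun p := ⟨p.1, p.2.1, p.2.2.1, p.2.2.2.1, p.2.2.2.2⟩
  invFun ω := ⟨ω.j0, ω.j1, ω.S0, ω.S1, ω.f⟩
  left_inv _ := rfl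
  right_inv _ := rfl

instance (m ℓ : ℕ) : Fintype (DecTuple m ℓ) :=
  Fintype.ofEquiv _ (DecTuple.equivProd m ℓ)

/-- A decoding tuple is valid for `b` used bits if the two queried positions are
distinct, the two sets have size `b`, and the output function depends only on the
answer bits in `S0` resp. `S1`. -/
def DecTuple.Valid {m ℓ : ℕ} (b : ℕ) (ω : DecTuple m ℓ) : Prop :=
  ω.j0 ≠ ω.j1 ∧ ω.S0.card = b ∧ ω.S1.card = b ∧
    ∀ a0 a1 a0' a1' : Fin ℓ → Bool,
      (∀ k ∈ ω.S0, a0 k = a0' k) → (∀ k ∈ ω.S1, a1 k = a1' k) →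
        ω.f a0 a1 = ω.f a0' a1'

/-- `D` is a distribution over decoding tuples witnessing that `C` is a
`(2, c, ε)`-smooth code using `b` bits at index `i`. -/
def IsSmoothDecoder {n m ℓ : ℕ} (b : ℕ) (c ε : ℝ)
    (C : (Fin n → Bool) → Fin m → Fin ℓ → Bool) (i : Fin n)
    (D : DecTuple m ℓ → ℝ) : Prop :=
  (∀ ω, 0 ≤ D ω) ∧ (∑ ω, D ω = 1) ∧
  (∀ ω, D ω ≠ 0 → ω.Valid b) ∧
  (∀ x, 1 / 2 + ε ≤
    ∑ ω ∈ Finset.univ.filter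
      (fun ω : DecTuple m ℓ => ω.f (C x ω.j0) (C x ω.j1) = x i), D ω) ∧
  (∀ j : Fin m,
    ∑ ω ∈ Finset.univ.filter
      (fun ω : DecTuple m ℓ => ω.j0 = j ∨ ω.j1 = j), D ω ≤ c / m)

/-- `C : {0,1}^n → ({0,1}^ℓ)^m` is a `(2, c, ε)`-smooth code using `b` bits. -/
def IsSmoothCode (n m ℓ b : ℕ) (c ε : ℝ)
    (C : (Fin n → Bool) → Fin m → Fin ℓ → Bool) : Prop :=
  ∀ i : Fin n, ∃ D : DecTuple m ℓ → ℝ, IsSmoothDecoder b c ε C i D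

/-- The binary entropy function `H(p) = -p log₂ p - (1-p) log₂ (1-p)`. -/
noncomputable def binEnt (p : ℝ) : ℝ :=
  -p * Real.logb 2 p - (1 - p) * Real.logb 2 (1 - p)

section Auxiliary

open Matrix

/-- `ρ = U diag(r) Uᵀ` with `U` orthogonal. -/
structure IsSpectralDecomp {ι : Type*} [Fintype ι] [DecidableEq ι]
    (ρ U : Matrix ι ι ℝ) (r : ι → ℝ) : Prop where
  transpose_mul : Uᵀ * U = 1
  eq : ρ = U * diagonal r * Uᵀ

open Filter Topology in
lemma sum_mul_log_le_of_resolvent {α κ : Type*} [Fintype α] [Fintype κ] {P z : α → ℝ}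
    {p y e : κ → ℝ} (hz : ∀ i, 0 < z i) (hy : ∀ k, 0 < y k) (hsum : ∑ i, P i = ∑ k, p k)
    (h : ∀ s : ℝ, 0 < s →
      ∑ k, (p k / (s + y k) + e k / (s + y k) ^ 2) ≤ ∑ i, P i / (s + z i)) :
    ∑ i, P i * Real.log (z i) ≤ ∑ k, (p k * Real.log (y k) - e k / y k) := by
  set G : ℝ → ℝ := fun s => ∑ i, P i * Real.log (s + z i) -
    ∑ k, (p k * Real.log (s + y k) - e k / (s + y k)) with hG
  have hderiv : ∀ s : ℝ, 0 ≤ s → HasDerivAt G (∑ i, P i / (s + z i) -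
      ∑ k, (p k / (s + y k) + e k / (s + y k) ^ 2)) s := by
    intro s hs
    refine HasDerivAt.sub (HasDerivAt.fun_sum fun i _ => ?_) (HasDerivAt.fun_sum fun k _ => ?_)
    · have := ((hasDerivAt_id s).add_const (z i)).log (by have := hz i; simp; positivity)
      simpa [div_eq_mul_inv] using this.const_mul (P i)
    · have hk := hy k
      have hne : s + y k ≠ 0 := by positivity
      have h1 := (((hasDerivAt_id s).add_const (y k)).log hne).const_mul (p k)
      have h2 := (((hasDerivAt_id s).add_const (y k)).inv hne).const_mul (e k)
      convert h1.sub h2 using 1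
      · funext x
        simp [div_eq_mul_inv]
      · simp only [id]
        ring
  have hmono : MonotoneOn G (Set.Ici 0) := by
    refine monotoneOn_of_deriv_nonneg (convex_Ici 0)
      (fun s hs => (hderiv s hs).continuousAt.continuousWithinAt)
      (fun s hs => ?_) (fun s hs => ?_)
    · rw [interior_Ici] at hs
      exact (hderiv s (le_of_lt hs)).differentiableAt.differentiableWithinAt
    · rw [interior_Ici] at hs
      rw [(hderiv s (le_of_lt hs)).deriv]
      linarith [h s hs]
  have hlim : Tendsto G atTop (𝓝 0) := by
    have h1 : Tendsto (fun s : ℝ => ∑ i, P i * (Real.log (s + z i) - Real.log s) -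
        ∑ k, (p k * (Real.log (s + y k) - Real.log s) - e k / (s + y k))) atTop
        (𝓝 (∑ i, P i * 0 - ∑ k, (p k * 0 - 0))) := by
      refine Tendsto.sub (tendsto_finsetSum _ fun i _ => ?_) (tendsto_finsetSum _ fun k _ => ?_)
      · exact (Real.tendsto_log_comp_add_sub_log (z i)).const_mul _
      · refine ((Real.tendsto_log_comp_add_sub_log (y k)).const_mul _).sub ?_
        exact (tendsto_atTop_add_const_right _ _ tendsto_id).const_div_atTop _
    convert h1 using 1
    · funext s
      have hs : (∑ i, P i) * Real.log s = (∑ k, p k) * Real.log s := by rw [hsum]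
      simp only [hG, mul_sub, Finset.sum_sub_distrib]
      rw [← Finset.sum_mul, ← Finset.sum_mul]
      linarith
    · simp
  have h0 : G 0 ≤ 0 := by
    refine ge_of_tendsto hlim ?_
    filter_upwards [eventually_ge_atTop 0] with s hs
    exact hmono (Set.mem_Ici.2 le_rfl) hs hs
  simp only [hG, zero_add] at h0
  linarith

namespace IsSpectralDecomp

variable {ι : Type*} [Fintype ι] [DecidableEq ι] {ρ U : Matrix ι ι ℝ} {r : ι → ℝ}

lemma mul_transpose (h : IsSpectralDecomp ρ U r) : U * Uᵀ = 1 :=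
  mul_eq_one_comm.1 h.transpose_mul

lemma conj_eq (h : IsSpectralDecomp ρ U r) : Uᵀ * ρ * U = diagonal r := by
  rw [h.eq]
  calc Uᵀ * (U * diagonal r * Uᵀ) * U = (Uᵀ * U) * diagonal r * (Uᵀ * U) := by
        simp only [Matrix.mul_assoc]
    _ = _ := by simp [h.transpose_mul]

lemma trace_mul (h : IsSpectralDecomp ρ U r) (M : Matrix ι ι ℝ) :
    trace (ρ * M) = ∑ a, r a * (Uᵀ * M * U) a a := by
  rw [h.eq, Matrix.mul_assoc, Matrix.mul_assoc, Matrix.trace_mul_comm, Matrix.mul_assoc]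
  simp [trace, diagonal_mul, Matrix.mul_assoc]

lemma trace_eq (h : IsSpectralDecomp ρ U r) : trace ρ = ∑ a, r a := by
  have := h.trace_mul 1
  simpa [h.transpose_mul] using this

lemma nonneg (h : IsSpectralDecomp ρ U r) (hρ : ρ.PosSemidef) (a : ι) : 0 ≤ r a := by
  have := (hρ.conjTranspose_mul_mul_same U).diag_nonneg (i := a)
  rw [conjTranspose_eq_transpose_of_trivial, h.conj_eq] at this
  simpa using this

lemma trace_mul_nonneg (h : IsSpectralDecomp ρ U r) (hr : ∀ a, 0 ≤ r a)
    {M : Matrix ι ι ℝ} (hM : M.PosSemidef) : 0 ≤ trace (ρ * M) := by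
  rw [h.trace_mul]
  refine Finset.sum_nonneg fun a _ => mul_nonneg (hr a) ?_
  have := (hM.conjTranspose_mul_mul_same U).diag_nonneg (i := a)
  rwa [conjTranspose_eq_transpose_of_trivial] at this

lemma exists_of_posSemidef (hρ : ρ.PosSemidef) : ∃ U r, IsSpectralDecomp ρ U r := by
  refine ⟨hρ.1.eigenvectorUnitary, hρ.1.eigenvalues, ?_, ?_⟩
  · have := Unitary.coe_star_mul_self hρ.1.eigenvectorUnitary
    rwa [star_eq_conjTranspose, conjTranspose_eq_transpose_of_trivial] at this
  · have := hρ.1.spectral_theorem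
    rw [Unitary.conjStarAlgAut_apply, star_eq_conjTranspose,
      conjTranspose_eq_transpose_of_trivial] at this
    exact this

end IsSpectralDecomp

/-- Measurement monotonicity of quantum relative entropy, in dual form. -/
theorem sum_log_weight_le_relEntropy {ι κ : Type*} [Fintype ι] [DecidableEq ι] [Fintype κ]
    {ρ σ U W : Matrix ι ι ℝ} {r s : ι → ℝ}
    (hρ : IsSpectralDecomp ρ U r) (hσ : IsSpectralDecomp σ W s)
    (hr : ∀ a, 0 ≤ r a) (hs : ∀ c, 0 ≤ s c)
    (hsupp : ∀ c, s c = 0 → (Wᵀ * ρ * W) c c = 0)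
    (E : κ → Matrix ι ι ℝ) (hE : ∀ k, (E k).PosSemidef) (hE1 : ∑ k, E k = 1)
    (w : κ → ℝ) (hw : ∀ k, 0 < w k) :
    ∑ k, (trace (ρ * E k) * Real.log (w k) - w k * trace (σ * E k)) + trace ρ ≤
      ∑ a, r a * Real.log (r a) - ∑ c, (Wᵀ * ρ * W) c c * Real.log (s c) := by
  set V : Matrix ι ι ℝ := Wᵀ * U with hV
  have hVV : Vᵀ * V = 1 := by
    rw [hV, transpose_mul, transpose_transpose]
    calc Uᵀ * W * (Wᵀ * U) = Uᵀ * (W * Wᵀ) * U := by simp only [Matrix.mul_assoc]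
      _ = 1 := by rw [hσ.mul_transpose, Matrix.mul_one, hρ.transpose_mul]
  have hdiag : ∀ c, (Wᵀ * ρ * W) c c = ∑ a, r a * V c a ^ 2 := by
    intro c
    have : Wᵀ * ρ * W = V * diagonal r * Vᵀ := by
      rw [hρ.eq, hV, transpose_mul, transpose_transpose]; simp only [Matrix.mul_assoc]
    rw [this, Matrix.mul_apply]
    refine Finset.sum_congr rfl fun a _ => ?_
    rw [mul_diagonal, transpose_apply]; ring
  have hcol : ∀ a, ∑ c, V c a ^ 2 = 1 := by
    intro a
    have := congrFun (congrFun hVV a) a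
    rw [Matrix.mul_apply, one_apply_eq] at this
    rw [← this]
    exact Finset.sum_congr rfl fun c _ => by rw [transpose_apply]; ring
  -- the Nussbaum–Szkoła distribution
  set P : ι × ι → ℝ := fun x => r x.2 * V x.1 x.2 ^ 2 with hP
  set z : ι × ι → ℝ := fun x => if P x = 0 then 1 else s x.1 / r x.2 with hz
  have hpos : ∀ x, P x ≠ 0 → 0 < r x.2 ∧ 0 < s x.1 := by
    intro x hx
    refine ⟨lt_of_le_of_ne (hr _) fun h => hx (by simp [hP, ← h]),
      lt_of_le_of_ne (hs _) fun h => hx ?_⟩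
    have := hsupp x.1 h.symm
    rw [hdiag, Finset.sum_eq_zero_iff_of_nonneg fun a _ => mul_nonneg (hr _) (sq_nonneg _)] at this
    exact this x.2 (Finset.mem_univ _)
  have hzpos : ∀ x, 0 < z x := by
    intro x
    simp only [hz]
    split_ifs with h
    · exact one_pos
    · exact div_pos (hpos x h).2 (hpos x h).1
  have hPr : ∀ f : ι → ℝ, ∑ x, P x * f x.2 = ∑ a, r a * f a := by
    intro f
    rw [Fintype.sum_prod_type, Finset.sum_comm]
    refine Finset.sum_congr rfl fun a _ => ?_
    calc ∑ c, P (c, a) * f a = r a * f a * ∑ c, V c a ^ 2 := by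
          rw [Finset.mul_sum]; exact Finset.sum_congr rfl fun c _ => by simp only [hP]; ring
      _ = _ := by rw [hcol, mul_one]
  have hPs : ∀ f : ι → ℝ, ∑ x, P x * f x.1 = ∑ c, (Wᵀ * ρ * W) c c * f c := by
    intro f
    rw [Fintype.sum_prod_type]
    exact Finset.sum_congr rfl fun c _ => by rw [hdiag, Finset.sum_mul]
  have hsum : ∑ x, P x = ∑ k, trace (ρ * E k) := by
    rw [← trace_sum, ← Matrix.mul_sum, hE1, Matrix.mul_one, hρ.trace_eq]
    simpa using hPr fun _ => 1
  have key := sum_mul_log_le_of_resolvent (P := P) (z := z) (p := fun k => trace (ρ * E k))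
    (y := fun k => (w k)⁻¹) (e := fun k => trace (ρ * E k) * (w k)⁻¹ - trace (σ * E k))
    hzpos (fun k => inv_pos.2 (hw k)) hsum ?_
  · have hlog : ∑ x, P x * Real.log (z x) =
        ∑ c, (Wᵀ * ρ * W) c c * Real.log (s c) - ∑ a, r a * Real.log (r a) := by
      rw [← hPs, ← hPr, ← Finset.sum_sub_distrib]
      refine Finset.sum_congr rfl fun x _ => ?_
      by_cases hx : P x = 0
      · simp [hx]
      · have h1 := hpos x hx
        simp only [hz, if_neg hx]
        rw [Real.log_div h1.2.ne' h1.1.ne']; ring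
    rw [hlog] at key
    have hrw : ∑ k, (trace (ρ * E k) * Real.log (w k)⁻¹ -
        (trace (ρ * E k) * (w k)⁻¹ - trace (σ * E k)) / (w k)⁻¹) =
        -(∑ k, (trace (ρ * E k) * Real.log (w k) - w k * trace (σ * E k)) + trace ρ) := by
      have : trace ρ = ∑ k, trace (ρ * E k) := by
        rw [← trace_sum, ← Matrix.mul_sum, hE1, Matrix.mul_one]
      rw [this, ← Finset.sum_add_distrib, ← Finset.sum_neg_distrib]
      refine Finset.sum_congr rfl fun k _ => ?_
      rw [Real.log_inv]
      have := (hw k).ne'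
      field_simp
      ring
    rw [hrw] at key
    linarith
  intro t ht
  set l : κ → ℝ := fun k => (t + (w k)⁻¹)⁻¹ with hl
  set Y : Matrix ι ι ℝ := ∑ k, l k • E k with hY
  have hYT : Yᵀ = Y := by
    rw [hY, transpose_sum]
    refine Finset.sum_congr rfl fun k _ => ?_
    rw [transpose_smul, ← conjTranspose_eq_transpose_of_trivial, (hE k).1.eq]
  set y : Matrix ι ι ℝ := Wᵀ * Y * U with hy
  have hpt : ∀ x : ι × ι, 2 * (r x.2 * V x.1 x.2 * y x.1 x.2) -
      (t * (r x.2 * y x.1 x.2 ^ 2) + s x.1 * y x.1 x.2 ^ 2) ≤ P x / (t + z x) := by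
    intro x
    by_cases hx : P x = 0
    · rw [hx, zero_div]
      have : r x.2 * V x.1 x.2 = 0 := by
        simp only [hP] at hx
        rcases mul_eq_zero.1 hx with h | h
        · simp [h]
        · simp [pow_eq_zero_iff] at h; simp [h]
      rw [this]
      have h1 := hr x.2
      have h2 := hs x.1
      have : 0 ≤ t * (r x.2 * y x.1 x.2 ^ 2) + s x.1 * y x.1 x.2 ^ 2 := by positivity
      linarith
    · have ⟨h1, h2⟩ := hpos x hx
      simp only [hz, if_neg hx]
      rw [le_div_iff₀ (by positivity)]
      have h3 : s x.1 = r x.2 * (s x.1 / r x.2) := by field_simp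
      set q := s x.1 / r x.2
      rw [h3]
      simp only [hP]
      have := mul_nonneg h1.le (sq_nonneg (V x.1 x.2 - y x.1 x.2 * (t + q)))
      nlinarith [this]
  have hvy : ∑ x : ι × ι, r x.2 * V x.1 x.2 * y x.1 x.2 = trace (ρ * Y) := by
    rw [hρ.trace_mul, Fintype.sum_prod_type, Finset.sum_comm]
    refine Finset.sum_congr rfl fun a _ => ?_
    have : Uᵀ * Y * U = Vᵀ * y := by
      rw [hV, hy, transpose_mul, transpose_transpose]
      calc Uᵀ * Y * U = Uᵀ * (1 * Y) * U := by rw [Matrix.one_mul]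
        _ = _ := by rw [← hσ.mul_transpose]; simp only [Matrix.mul_assoc]
    rw [this, Matrix.mul_apply, Finset.mul_sum]
    exact Finset.sum_congr rfl fun c _ => by rw [transpose_apply]; ring
  have hyr : ∑ x : ι × ι, r x.2 * y x.1 x.2 ^ 2 = trace (ρ * (Y * Y)) := by
    rw [hρ.trace_mul, Fintype.sum_prod_type, Finset.sum_comm]
    refine Finset.sum_congr rfl fun a _ => ?_
    have : Uᵀ * (Y * Y) * U = yᵀ * y := by
      rw [hy, transpose_mul, transpose_mul, transpose_transpose, hYT]
      calc Uᵀ * (Y * Y) * U = Uᵀ * (Y * (1 * Y)) * U := by rw [Matrix.one_mul]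
        _ = _ := by rw [← hσ.mul_transpose]; simp only [Matrix.mul_assoc]
    rw [this, Matrix.mul_apply, Finset.mul_sum]
    exact Finset.sum_congr rfl fun c _ => by rw [transpose_apply]; ring
  have hys : ∑ x : ι × ι, s x.1 * y x.1 x.2 ^ 2 = trace (σ * (Y * Y)) := by
    rw [hσ.trace_mul, Fintype.sum_prod_type]
    refine Finset.sum_congr rfl fun c _ => ?_
    have : Wᵀ * (Y * Y) * W = y * yᵀ := by
      rw [hy, transpose_mul, transpose_mul, transpose_transpose, hYT]
      calc Wᵀ * (Y * Y) * W = Wᵀ * (Y * (1 * Y)) * W := by rw [Matrix.one_mul]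
        _ = _ := by rw [← hρ.mul_transpose]; simp only [Matrix.mul_assoc]
    rw [this, Matrix.mul_apply, Finset.mul_sum]
    exact Finset.sum_congr rfl fun a _ => by rw [transpose_apply]; ring
  have hYle : (∑ k, l k ^ 2 • E k - Y * Y).PosSemidef := by
    have h1 : (∑ k, (l k • (1 : Matrix ι ι ℝ) - Y)ᴴ * E k * (l k • 1 - Y)).PosSemidef :=
      posSemidef_sum _ fun k _ => (hE k).conjTranspose_mul_mul_same _
    convert h1 using 1
    have h2 : ∀ k, (l k • (1 : Matrix ι ι ℝ) - Y)ᴴ * E k * (l k • 1 - Y) =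
        l k ^ 2 • E k - Y * (l k • E k) - (l k • E k) * Y + Y * E k * Y := by
      intro k
      rw [conjTranspose_eq_transpose_of_trivial, transpose_sub, transpose_smul, transpose_one, hYT]
      simp only [Matrix.sub_mul, Matrix.mul_sub, Matrix.smul_mul, Matrix.mul_smul,
        Matrix.one_mul, Matrix.mul_one, sq]
      module
    simp only [h2, Finset.sum_add_distrib, Finset.sum_sub_distrib, ← Matrix.mul_sum,
      ← Matrix.sum_mul, hE1, Matrix.mul_one, ← hY]
    abel
  have hbd : ∀ {τ Q : Matrix ι ι ℝ} {q : ι → ℝ}, IsSpectralDecomp τ Q q → (∀ a, 0 ≤ q a) →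
      trace (τ * (Y * Y)) ≤ ∑ k, l k ^ 2 * trace (τ * E k) := by
    intro τ Q q hτ hq
    have := hτ.trace_mul_nonneg hq hYle
    rw [Matrix.mul_sub, trace_sub, Matrix.mul_sum, trace_sum] at this
    simp only [Matrix.mul_smul, trace_smul, smul_eq_mul] at this
    linarith
  have hρY : trace (ρ * Y) = ∑ k, l k * trace (ρ * E k) := by
    rw [hY, Matrix.mul_sum, trace_sum]
    simp only [Matrix.mul_smul, trace_smul, smul_eq_mul]
  have hfin := Finset.sum_le_sum fun x (_ : x ∈ Finset.univ) => hpt x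
  simp only [Finset.sum_sub_distrib, Finset.sum_add_distrib, ← Finset.mul_sum] at hfin
  rw [hvy, hyr, hys, hρY] at hfin
  have h1 := mul_le_mul_of_nonneg_left (hbd hρ hr) ht.le
  have h2 := hbd hσ hs
  refine le_trans (le_of_eq ?_) (le_trans (sub_le_sub_left (add_le_add h1 h2) _) hfin)
  rw [Finset.mul_sum, Finset.mul_sum, ← Finset.sum_add_distrib, ← Finset.sum_sub_distrib]
  refine Finset.sum_congr rfl fun k _ => ?_
  have : 0 < t + (w k)⁻¹ := add_pos ht (inv_pos.2 (hw k))
  simp only [hl]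
  have hc : (w k)⁻¹ = (t + (w k)⁻¹) - t := by ring
  generalize t + (w k)⁻¹ = v at *
  rw [hc]
  field_simp
  ring

/-- The sign `(-1)^b` of a bit. -/
def bitSign (b : Bool) : ℝ := if b then -1 else 1

lemma relEntropy_ge_of_observable {ι : Type*} [Fintype ι] [DecidableEq ι]
    {ρ σ U W : Matrix ι ι ℝ} {r s : ι → ℝ}
    (hρ : IsSpectralDecomp ρ U r) (hσ : IsSpectralDecomp σ W s)
    (hr : ∀ a, 0 ≤ r a) (hs : ∀ c, 0 ≤ s c)
    (hsupp : ∀ c, s c = 0 → (Wᵀ * ρ * W) c c = 0)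
    {E A : Matrix ι ι ℝ} (hadd : (E + A).PosSemidef) (hsub : (E - A).PosSemidef)
    (hE : (1 - E).PosSemidef) {t : ℝ} (ht : |t| < 1) :
    (Real.log (1 + t) + Real.log (1 - t)) / 2 * trace (ρ * E) +
      (Real.log (1 + t) - Real.log (1 - t)) / 2 * trace (ρ * A) -
      t * trace (σ * A) + trace ρ - trace σ ≤
      ∑ a, r a * Real.log (r a) - ∑ c, (Wᵀ * ρ * W) c c * Real.log (s c) := by
  obtain ⟨h1, h2⟩ := abs_lt.1 ht
  have key := sum_log_weight_le_relEntropy hρ hσ hr hs hsupp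
    ![(1 / 2 : ℝ) • (E + A), (1 / 2 : ℝ) • (E - A), 1 - E]
    (by
      intro k
      fin_cases k
      · exact hadd.smul (by norm_num)
      · exact hsub.smul (by norm_num)
      · exact hE)
    (by simp only [Fin.sum_univ_three, cons_val]; module)
    ![1 + t, 1 - t, 1]
    (by
      intro k
      fin_cases k
      · simp; linarith
      · simp; linarith
      · simp)
  simp only [Fin.sum_univ_three, cons_val, Matrix.mul_smul, Matrix.mul_add, Matrix.mul_sub,
    trace_smul, trace_add, trace_sub, smul_eq_mul, Matrix.mul_one, Real.log_one] at key
  linarith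

/-- An observable predicting the fair bit `b` from `ρ b` lowers the entropy accordingly. -/
lemma entropy_add_le_of_observable {ι : Type*} [Fintype ι] [DecidableEq ι]
    {ρ U : Bool → Matrix ι ι ℝ} {r : Bool → ι → ℝ} {W : Matrix ι ι ℝ} {s : ι → ℝ}
    (hpos : ∀ b, (ρ b).PosSemidef)
    (hρ : ∀ b, IsSpectralDecomp (ρ b) (U b) (r b))
    (hσ : IsSpectralDecomp ((1 / 2 : ℝ) • (ρ false + ρ true)) W s)
    {E A : Matrix ι ι ℝ} (hadd : (E + A).PosSemidef) (hsub : (E - A).PosSemidef)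
    (hE : (1 - E).PosSemidef) {t : ℝ} (ht : |t| < 1) {δ : ℝ}
    (hδ : ∀ b, δ ≤ (Real.log (1 + t) + Real.log (1 - t)) / 2 * trace (ρ b * E) +
      (Real.log (1 + t) - Real.log (1 - t)) / 2 * (bitSign b * trace (ρ b * A))) :
    (∑ a, Real.negMulLog (r false a) + ∑ a, Real.negMulLog (r true a)) / 2 + δ ≤
      ∑ c, Real.negMulLog (s c) := by
  have hσpos : ((1 / 2 : ℝ) • (ρ false + ρ true)).PosSemidef :=
    ((hpos false).add (hpos true)).smul (by norm_num)
  have hs := hσ.nonneg hσpos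
  have hdiag : ∀ b c, 0 ≤ (Wᵀ * ρ b * W) c c := fun b c => by
    have := ((hpos b).conjTranspose_mul_mul_same W).diag_nonneg (i := c)
    rwa [conjTranspose_eq_transpose_of_trivial] at this
  have havg : ∀ c, s c = ((Wᵀ * ρ false * W) c c + (Wᵀ * ρ true * W) c c) / 2 := by
    intro c
    have := congrFun (congrFun hσ.conj_eq c) c
    rw [diagonal_apply_eq] at this
    rw [← this]
    simp only [Matrix.mul_smul, Matrix.smul_mul, Matrix.mul_add, Matrix.add_mul, Matrix.smul_apply,
      Matrix.add_apply, smul_eq_mul]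
    ring
  have hsupp : ∀ b c, s c = 0 → (Wᵀ * ρ b * W) c c = 0 := by
    intro b c hc
    have h1 := havg c
    have h2 := hdiag false c
    have h3 := hdiag true c
    cases b <;> linarith
  have k0 := relEntropy_ge_of_observable (hρ false) hσ ((hρ false).nonneg (hpos false)) hs
    (hsupp false) hadd hsub hE ht
  have k1 := relEntropy_ge_of_observable (hρ true) hσ ((hρ true).nonneg (hpos true)) hs
    (hsupp true) hadd hsub hE (t := -t) (by rwa [abs_neg])
  have d0 := hδ false
  have d1 := hδ true
  simp only [bitSign] at d0 d1
  have hS : ∑ c, Real.negMulLog (s c) = -(∑ c, (Wᵀ * ρ false * W) c c * Real.log (s c) +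
      ∑ c, (Wᵀ * ρ true * W) c c * Real.log (s c)) / 2 := by
    rw [← Finset.sum_add_distrib, ← Finset.sum_neg_distrib, Finset.sum_div]
    refine Finset.sum_congr rfl fun c _ => ?_
    rw [Real.negMulLog]
    nth_rewrite 1 [havg c]
    ring
  have hr : ∀ b, ∑ a, Real.negMulLog (r b a) = -∑ a, r b a * Real.log (r b a) := by
    intro b
    rw [← Finset.sum_neg_distrib]
    exact Finset.sum_congr rfl fun a _ => by rw [Real.negMulLog]; ring
  have htr : trace ((1 / 2 : ℝ) • (ρ false + ρ true)) =
      (trace (ρ false) + trace (ρ true)) / 2 := by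
    simp only [trace_smul, trace_add, smul_eq_mul]; ring
  rw [hS, hr, hr]
  rw [htr] at k0 k1
  norm_num at d0 d1
  rw [sub_neg_eq_add, ← sub_eq_add_neg] at k1
  linarith

/-- Nayak's bound: the entropy of the average state of an encoding of `k` uniform bits is at
least `k` times the information that can be extracted about each bit. -/
theorem mul_le_entropy_of_observables {ι : Type*} [Fintype ι] [DecidableEq ι]
    {t δ : ℝ} (ht : |t| < 1) (k : ℕ) (ρ : (Fin k → Bool) → Matrix ι ι ℝ)
    (hpos : ∀ x, (ρ x).PosSemidef) (htr : ∀ x, trace (ρ x) = 1)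
    (E A : Fin k → Matrix ι ι ℝ)
    (hadd : ∀ i, (E i + A i).PosSemidef) (hsub : ∀ i, (E i - A i).PosSemidef)
    (hE : ∀ i, (1 - E i).PosSemidef)
    (hδ : ∀ x i, δ ≤ (Real.log (1 + t) + Real.log (1 - t)) / 2 * trace (ρ x * E i) +
      (Real.log (1 + t) - Real.log (1 - t)) / 2 * (bitSign (x i) * trace (ρ x * A i)))
    (W : Matrix ι ι ℝ) (s : ι → ℝ)
    (hW : IsSpectralDecomp (((2 : ℝ) ^ k)⁻¹ • ∑ x, ρ x) W s) :
    k * δ ≤ ∑ c, Real.negMulLog (s c) := by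
  induction k generalizing W s with
  | zero =>
    have hpos' : (((2 : ℝ) ^ 0)⁻¹ • ∑ x, ρ x).PosSemidef :=
      (posSemidef_sum _ fun x _ => hpos x).smul (by norm_num)
    have h1 : ∑ a, s a = 1 := by
      rw [← hW.trace_eq]
      simp [htr]
    have h0 := hW.nonneg hpos'
    simp only [Nat.cast_zero, zero_mul]
    refine Finset.sum_nonneg fun c _ => Real.negMulLog_nonneg (h0 c) ?_
    rw [← h1]
    exact Finset.single_le_sum (fun a _ => h0 a) (Finset.mem_univ c)
  | succ k ih =>
    set σ : Bool → Matrix ι ι ℝ :=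
      fun b => ((2 : ℝ) ^ k)⁻¹ • ∑ x : Fin k → Bool, ρ (Fin.cons b x) with hσ
    have hσpos : ∀ b, (σ b).PosSemidef := fun b =>
      (posSemidef_sum _ fun x _ => hpos _).smul (by positivity)
    have hsplit : ((2 : ℝ) ^ (k + 1))⁻¹ • ∑ x, ρ x = (1 / 2 : ℝ) • (σ false + σ true) := by
      rw [← (Fin.consEquiv fun _ => Bool).sum_comp, Fintype.sum_prod_type, Fintype.sum_bool]
      simp only [hσ, ← smul_add, smul_smul]
      rw [add_comm (Finset.sum _ _), show ((2 : ℝ) ^ (k + 1))⁻¹ = 1 / 2 * ((2 : ℝ) ^ k)⁻¹ by ring]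
      rfl
    rw [hsplit] at hW
    choose U r hUr using fun b => IsSpectralDecomp.exists_of_posSemidef (hσpos b)
    have hih : ∀ b, k * δ ≤ ∑ a, Real.negMulLog (r b a) := fun b =>
      ih (fun x => ρ (Fin.cons b x)) (fun x => hpos _) (fun x => htr _)
        (fun i => E i.succ) (fun i => A i.succ) (fun i => hadd _) (fun i => hsub _)
        (fun i => hE _) (fun x i => by simpa using hδ (Fin.cons b x) i.succ) _ _ (hUr b)
    have hlin : ∀ b (M : Matrix ι ι ℝ), trace (σ b * M) =
        ((2 : ℝ) ^ k)⁻¹ * ∑ x : Fin k → Bool, trace (ρ (Fin.cons b x) * M) := by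
      intro b M
      simp only [hσ, Matrix.smul_mul, Matrix.sum_mul, trace_smul, trace_sum, smul_eq_mul]
    have hstep := entropy_add_le_of_observable hσpos hUr hW (hadd 0) (hsub 0) (hE 0) ht
      (δ := δ) (by
        intro b
        rw [hlin, hlin]
        have hsum := Finset.sum_le_sum fun (x : Fin k → Bool) (_ : x ∈ Finset.univ) =>
          hδ (Fin.cons b x) 0
        simp only [Fin.cons_zero, Finset.sum_add_distrib, ← Finset.mul_sum, Finset.sum_const,
          Finset.card_univ, Fintype.card_pi, Fintype.card_bool, Finset.prod_const,
          Fintype.card_fin, nsmul_eq_mul, Nat.cast_pow, Nat.cast_ofNat] at hsum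
        have h2 : (0 : ℝ) < 2 ^ k := by positivity
        rw [← mul_le_mul_iff_right₀ h2]
        refine hsum.trans (le_of_eq ?_)
        field_simp)
    have h0 := hih false
    have h1 := hih true
    push_cast
    linarith

lemma sum_negMulLog_le_log_card {ι : Type*} [Fintype ι] [Nonempty ι] {s : ι → ℝ}
    (hs : ∀ i, 0 ≤ s i) (h1 : ∑ i, s i = 1) :
    ∑ i, Real.negMulLog (s i) ≤ Real.log (Fintype.card ι) := by
  have hN : (0 : ℝ) < Fintype.card ι := by exact_mod_cast Fintype.card_pos
  have := Real.concaveOn_negMulLog.le_map_sum (t := Finset.univ)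
    (w := fun _ : ι => (Fintype.card ι : ℝ)⁻¹) (p := s) (fun _ _ => by positivity)
    (by simp [hN.ne']) (fun i _ => hs i)
  simp only [smul_eq_mul, ← Finset.mul_sum, h1, mul_one, Real.negMulLog_def, Real.log_inv] at this
  simp only [Real.negMulLog_def]
  have h := mul_le_mul_of_nonneg_left this hN.le
  field_simp at h
  simpa only [neg_mul] using h

/-- An encoding of `k` bits into density matrices of dimension `|ι|` satisfies `k δ ≤ log |ι|`,
where `δ` is the information that can be extracted about each bit. -/
theorem mul_le_log_card_of_observables {ι : Type*} [Fintype ι] [DecidableEq ι] [Nonempty ι]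
    {t δ : ℝ} (ht : |t| < 1) (k : ℕ) (ρ : (Fin k → Bool) → Matrix ι ι ℝ)
    (hpos : ∀ x, (ρ x).PosSemidef) (htr : ∀ x, trace (ρ x) = 1)
    (E A : Fin k → Matrix ι ι ℝ)
    (hadd : ∀ i, (E i + A i).PosSemidef) (hsub : ∀ i, (E i - A i).PosSemidef)
    (hE : ∀ i, (1 - E i).PosSemidef)
    (hδ : ∀ x i, δ ≤ (Real.log (1 + t) + Real.log (1 - t)) / 2 * trace (ρ x * E i) +
      (Real.log (1 + t) - Real.log (1 - t)) / 2 * (bitSign (x i) * trace (ρ x * A i))) :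
    k * δ ≤ Real.log (Fintype.card ι) := by
  have hσ : (((2 : ℝ) ^ k)⁻¹ • ∑ x, ρ x).PosSemidef :=
    (posSemidef_sum _ fun x _ => hpos x).smul (by positivity)
  obtain ⟨W, s, hW⟩ := IsSpectralDecomp.exists_of_posSemidef hσ
  refine (mul_le_entropy_of_observables ht k ρ hpos htr E A hadd hsub hE hδ W s hW).trans
    (sum_negMulLog_le_log_card (hW.nonneg hσ) ?_)
  rw [← hW.trace_eq]
  simp [trace_sum, htr]

lemma bitSign_mul_self (b : Bool) : bitSign b * bitSign b = 1 := by
  cases b <;> norm_num [bitSign]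

lemma bitSign_not (b : Bool) : bitSign (!b) = -bitSign b := by
  cases b <;> norm_num [bitSign]

/-- The Walsh character `(-1)^(T · a)`. -/
def walsh {ℓ : ℕ} (T : Finset (Fin ℓ)) (a : Fin ℓ → Bool) : ℝ := ∏ k ∈ T, bitSign (a k)

section Walsh

variable {ℓ : ℕ}

lemma walsh_mul_self (T : Finset (Fin ℓ)) (a : Fin ℓ → Bool) : walsh T a * walsh T a = 1 := by
  simp [walsh, ← Finset.prod_mul_distrib, bitSign_mul_self]

lemma sum_walsh_mul_walsh (a a' : Fin ℓ → Bool) :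
    ∑ T, walsh T a * walsh T a' = if a = a' then 2 ^ ℓ else 0 := by
  have h : ∑ T, walsh T a * walsh T a' = ∏ k, (1 + bitSign (a k) * bitSign (a' k)) := by
    rw [Finset.prod_one_add, Finset.powerset_univ]
    exact Finset.sum_congr rfl fun T _ => by rw [walsh, walsh, Finset.prod_mul_distrib]
  rw [h]
  split_ifs with haa
  · subst haa
    simp only [bitSign_mul_self]
    norm_num
  · obtain ⟨k, hk⟩ := Function.ne_iff.1 haa
    refine Finset.prod_eq_zero (Finset.mem_univ k) ?_
    revert hk
    cases a k <;> cases a' k <;> norm_num [bitSign]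

/-- A function not depending on coordinate `k ∈ T` is orthogonal to the character of `T`. -/
lemma sum_mul_walsh_eq_zero {g : (Fin ℓ → Bool) → ℝ} {T : Finset (Fin ℓ)} {k : Fin ℓ}
    (hk : k ∈ T) (hg : ∀ a, g (Function.update a k (!a k)) = g a) :
    ∑ a, g a * walsh T a = 0 := by
  have hinv : Function.Involutive fun a : Fin ℓ → Bool => Function.update a k (!a k) := by
    intro a
    simp
  have hflip : ∀ a, walsh T (Function.update a k (!a k)) = -walsh T a := by
    intro a
    rw [walsh, walsh, ← Finset.mul_prod_erase T _ hk, ← Finset.mul_prod_erase T _ hk,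
      Function.update_self, bitSign_not, neg_mul]
    congr 2
    refine Finset.prod_congr rfl fun j hj => ?_
    rw [Function.update_of_ne (Finset.ne_of_mem_erase hj)]
  have h := Equiv.sum_comp (hinv.toPerm _) fun a => g a * walsh T a
  simp only [Function.Involutive.coe_toPerm, hg, hflip, mul_neg, Finset.sum_neg_distrib] at h
  linarith

/-- The Fourier coefficients of the sign function `(-1)^f`. -/
noncomputable def walshCoeff (f : (Fin ℓ → Bool) → (Fin ℓ → Bool) → Bool)
    (T₀ T₁ : Finset (Fin ℓ)) : ℝ :=
  ((2 : ℝ) ^ ℓ * 2 ^ ℓ)⁻¹ * ∑ a₀, ∑ a₁, bitSign (f a₀ a₁) * walsh T₁ a₁ * walsh T₀ a₀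

lemma sum_walshCoeff_mul (f : (Fin ℓ → Bool) → (Fin ℓ → Bool) → Bool)
    (a₀ a₁ : Fin ℓ → Bool) :
    ∑ T₀, ∑ T₁, walshCoeff f T₀ T₁ * (walsh T₀ a₀ * walsh T₁ a₁) = bitSign (f a₀ a₁) := by
  have h : ∑ T₀, ∑ T₁, walshCoeff f T₀ T₁ * (walsh T₀ a₀ * walsh T₁ a₁) =
      ((2 : ℝ) ^ ℓ * 2 ^ ℓ)⁻¹ * ∑ a₀', ∑ a₁', bitSign (f a₀' a₁') *
        ((∑ T₀, walsh T₀ a₀' * walsh T₀ a₀) * ∑ T₁, walsh T₁ a₁' * walsh T₁ a₁) := by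
    simp only [walshCoeff, Finset.mul_sum, Finset.sum_mul]
    calc _ = ∑ T₀, ∑ a₀', ∑ T₁, ∑ a₁', _ :=
          Finset.sum_congr rfl fun T₀ _ => Finset.sum_comm
      _ = ∑ a₀', ∑ T₀, ∑ T₁, ∑ a₁', _ := Finset.sum_comm
      _ = ∑ a₀', ∑ T₀, ∑ a₁', ∑ T₁, _ :=
          Finset.sum_congr rfl fun _ _ => Finset.sum_congr rfl fun _ _ => Finset.sum_comm
      _ = ∑ a₀', ∑ a₁', ∑ T₀, ∑ T₁, _ :=
          Finset.sum_congr rfl fun _ _ => Finset.sum_comm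
      _ = _ := by
          refine Finset.sum_congr rfl fun _ _ => Finset.sum_congr rfl fun _ _ => ?_
          rw [Finset.sum_comm]
          refine Finset.sum_congr rfl fun _ _ => Finset.sum_congr rfl fun _ _ => ?_
          ring
  rw [h]
  simp only [sum_walsh_mul_walsh, mul_ite, ite_mul, zero_mul, mul_zero,
    Finset.sum_ite_eq', Finset.mem_univ, if_true]
  have : (2 : ℝ) ^ ℓ ≠ 0 := by positivity
  field_simp

lemma sum_walshCoeff_sq (f : (Fin ℓ → Bool) → (Fin ℓ → Bool) → Bool) :
    ∑ T₀, ∑ T₁, walshCoeff f T₀ T₁ ^ 2 = 1 := by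
  have h : ∑ T₀, ∑ T₁, walshCoeff f T₀ T₁ ^ 2 =
      ((2 : ℝ) ^ ℓ * 2 ^ ℓ)⁻¹ * ∑ a₀, ∑ a₁, bitSign (f a₀ a₁) *
        ∑ T₀, ∑ T₁, walshCoeff f T₀ T₁ * (walsh T₀ a₀ * walsh T₁ a₁) := by
    have hsq : ∀ T₀ T₁, walshCoeff f T₀ T₁ ^ 2 = ∑ a₀, ∑ a₁, ((2 : ℝ) ^ ℓ * 2 ^ ℓ)⁻¹ *
        (bitSign (f a₀ a₁) * (walshCoeff f T₀ T₁ * (walsh T₀ a₀ * walsh T₁ a₁))) := by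
      intro T₀ T₁
      rw [sq]
      nth_rewrite 1 [walshCoeff]
      simp only [Finset.mul_sum, Finset.sum_mul]
      exact Finset.sum_congr rfl fun _ _ => Finset.sum_congr rfl fun _ _ => by ring
    simp only [hsq, Finset.mul_sum]
    calc _ = ∑ T₀, ∑ a₀, ∑ T₁, ∑ a₁, _ :=
          Finset.sum_congr rfl fun T₀ _ => Finset.sum_comm
      _ = ∑ a₀, ∑ T₀, ∑ T₁, ∑ a₁, _ := Finset.sum_comm
      _ = ∑ a₀, ∑ T₀, ∑ a₁, ∑ T₁, _ :=
          Finset.sum_congr rfl fun _ _ => Finset.sum_congr rfl fun _ _ => Finset.sum_comm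
      _ = _ := Finset.sum_congr rfl fun _ _ => Finset.sum_comm
  rw [h]
  simp only [sum_walshCoeff_mul, bitSign_mul_self]
  simp
  field_simp

end Walsh

section ValidTuple

variable {m ℓ b : ℕ} {ω : DecTuple m ℓ}

lemma walshCoeff_eq_zero_left (hω : ω.Valid b) {T₀ : Finset (Fin ℓ)} (h : ¬T₀ ⊆ ω.S0)
    (T₁ : Finset (Fin ℓ)) : walshCoeff ω.f T₀ T₁ = 0 := by
  obtain ⟨k, hk, hkS⟩ := Finset.not_subset.1 h
  rw [walshCoeff, Finset.sum_comm]
  refine mul_eq_zero_of_right _ (Finset.sum_eq_zero fun a₁ _ => ?_)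
  refine sum_mul_walsh_eq_zero (g := fun a₀ => bitSign (ω.f a₀ a₁) * walsh T₁ a₁) hk fun a => ?_
  rw [hω.2.2.2 _ a₁ a a₁ (fun j hj => Function.update_of_ne (by rintro rfl; exact hkS hj) _ _)
    fun _ _ => rfl]

lemma walshCoeff_eq_zero_right (hω : ω.Valid b) (T₀ : Finset (Fin ℓ))
    {T₁ : Finset (Fin ℓ)} (h : ¬T₁ ⊆ ω.S1) : walshCoeff ω.f T₀ T₁ = 0 := by
  obtain ⟨k, hk, hkS⟩ := Finset.not_subset.1 h
  refine mul_eq_zero_of_right _ (Finset.sum_eq_zero fun a₀ _ => ?_)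
  rw [← Finset.sum_mul]
  refine mul_eq_zero_of_left
    (sum_mul_walsh_eq_zero (g := fun a₁ => bitSign (ω.f a₀ a₁)) hk fun a => ?_) _
  rw [hω.2.2.2 a₀ _ a₀ a (fun _ _ => rfl)
    fun j hj => Function.update_of_ne (by rintro rfl; exact hkS hj) _ _]

end ValidTuple

/-- Positions in the code word together with a parity of at most `b` bits. -/
abbrev QueryIndex (m ℓ b : ℕ) : Type := Fin m × {T : Finset (Fin ℓ) // T.card ≤ b}

/-- The diagonal of the projection onto the coordinates that `ω` may use. -/
def DecTuple.support {m ℓ b : ℕ} (ω : DecTuple m ℓ) (x : QueryIndex m ℓ b) : ℝ :=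
  (if x.1 = ω.j0 then (if (x.2 : Finset (Fin ℓ)) ⊆ ω.S0 then 1 else 0) else 0) +
    if x.1 = ω.j1 then (if (x.2 : Finset (Fin ℓ)) ⊆ ω.S1 then 1 else 0) else 0

/-- The symmetric matrix whose off-diagonal block is formed by the Fourier coefficients of the
output function. -/
noncomputable def DecTuple.observable {m ℓ : ℕ} (b : ℕ) (ω : DecTuple m ℓ) :
    Matrix (QueryIndex m ℓ b) (QueryIndex m ℓ b) ℝ := fun x y =>
  (if x.1 = ω.j0 then (if y.1 = ω.j1 then walshCoeff ω.f x.2 y.2 else 0) else 0) +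
    if x.1 = ω.j1 then (if y.1 = ω.j0 then walshCoeff ω.f y.2 x.2 else 0) else 0

section Observable

variable {m ℓ b : ℕ} {ω : DecTuple m ℓ}

lemma sum_subtype_card_le {g : Finset (Fin ℓ) → ℝ} (hg : ∀ T, b < T.card → g T = 0) :
    ∑ T : {T : Finset (Fin ℓ) // T.card ≤ b}, g T = ∑ T, g T := by
  rw [← Finset.sum_subtype (Finset.univ.filter fun T : Finset (Fin ℓ) => T.card ≤ b) (by simp) g]
  refine Finset.sum_subset (Finset.subset_univ _) fun T _ hT => hg T ?_
  simpa using hT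

lemma card_queryIndex :
    Fintype.card (QueryIndex m ℓ b) = m * ∑ i ∈ Finset.range (b + 1), ℓ.choose i := by
  rw [Fintype.card_prod, Fintype.card_fin, Fintype.card_subtype]
  congr 1
  rw [Finset.card_eq_sum_card_fiberwise (f := Finset.card) (t := Finset.range (b + 1))
    (fun T hT => by simpa [Nat.lt_succ_iff] using hT)]
  refine Finset.sum_congr rfl fun i hi => ?_
  rw [Finset.mem_range] at hi
  have : (Finset.univ.filter fun T : Finset (Fin ℓ) => T.card ≤ b).filter
      (fun T => T.card = i) = Finset.powersetCard i Finset.univ := by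
    ext T
    simp only [Finset.mem_filter, Finset.mem_univ, true_and, Finset.mem_powersetCard,
      Finset.subset_univ]
    omega
  rw [this, Finset.card_powersetCard, Finset.card_univ, Fintype.card_fin]

lemma DecTuple.support_form (v : QueryIndex m ℓ b → ℝ) :
    ∑ x, ω.support x * v x ^ 2 =
      ∑ T : {T : Finset (Fin ℓ) // T.card ≤ b},
        (if (T : Finset (Fin ℓ)) ⊆ ω.S0 then v (ω.j0, T) ^ 2 else 0) +
      ∑ T : {T : Finset (Fin ℓ) // T.card ≤ b},
        (if (T : Finset (Fin ℓ)) ⊆ ω.S1 then v (ω.j1, T) ^ 2 else 0) := by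
  simp only [DecTuple.support, add_mul, Finset.sum_add_distrib, Fintype.sum_prod_type_right,
    ite_mul, zero_mul, one_mul, Finset.sum_ite_eq', Finset.mem_univ, if_true]

lemma DecTuple.observable_form (v : QueryIndex m ℓ b → ℝ) :
    v ⬝ᵥ (ω.observable b *ᵥ v) =
      2 * ∑ T : {T : Finset (Fin ℓ) // T.card ≤ b}, ∑ T' : {T : Finset (Fin ℓ) // T.card ≤ b},
        walshCoeff ω.f T T' * (v (ω.j0, T) * v (ω.j1, T')) := by
  have h : v ⬝ᵥ (ω.observable b *ᵥ v) =
      ∑ T : {T : Finset (Fin ℓ) // T.card ≤ b}, ∑ T' : {T : Finset (Fin ℓ) // T.card ≤ b},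
        (v (ω.j0, T) * (walshCoeff ω.f T T' * v (ω.j1, T')) +
          v (ω.j1, T) * (walshCoeff ω.f T' T * v (ω.j0, T'))) := by
    have hmul : ∀ x, (ω.observable b *ᵥ v) x =
        (if x.1 = ω.j0 then ∑ T' : {T : Finset (Fin ℓ) // T.card ≤ b},
          walshCoeff ω.f x.2 T' * v (ω.j1, T') else 0) +
        if x.1 = ω.j1 then ∑ T' : {T : Finset (Fin ℓ) // T.card ≤ b},
          walshCoeff ω.f T' x.2 * v (ω.j0, T') else 0 := by
      intro x
      simp only [mulVec, dotProduct, DecTuple.observable, add_mul, Finset.sum_add_distrib,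
        Fintype.sum_prod_type_right]
      congr 1 <;> split_ifs <;> simp
    simp only [dotProduct, hmul, mul_add, Finset.sum_add_distrib, Fintype.sum_prod_type_right,
      mul_ite, mul_zero, Finset.sum_ite_eq', Finset.mem_univ, if_true, Finset.mul_sum]
  rw [h]
  simp only [Finset.sum_add_distrib]
  rw [two_mul]
  congr 1
  · exact Finset.sum_congr rfl fun _ _ => Finset.sum_congr rfl fun _ _ => by ring
  · rw [Finset.sum_comm]
    exact Finset.sum_congr rfl fun _ _ => Finset.sum_congr rfl fun _ _ => by ring

lemma DecTuple.observable_isSymm : (ω.observable b)ᵀ = ω.observable b := by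
  ext x y
  simp only [transpose_apply, DecTuple.observable]
  split_ifs <;> ring

lemma DecTuple.Valid.abs_observable_form_le (hω : ω.Valid b) (v : QueryIndex m ℓ b → ℝ) :
    |v ⬝ᵥ (ω.observable b *ᵥ v)| ≤ ∑ x, ω.support x * v x ^ 2 := by
  rw [DecTuple.observable_form, DecTuple.support_form]
  set p : {T : Finset (Fin ℓ) // T.card ≤ b} → ℝ :=
    fun T => if (T : Finset (Fin ℓ)) ⊆ ω.S0 then v (ω.j0, T) else 0 with hp
  set q : {T : Finset (Fin ℓ) // T.card ≤ b} → ℝ :=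
    fun T => if (T : Finset (Fin ℓ)) ⊆ ω.S1 then v (ω.j1, T) else 0 with hq
  have hform : ∑ T : {T : Finset (Fin ℓ) // T.card ≤ b},
      ∑ T' : {T : Finset (Fin ℓ) // T.card ≤ b},
        walshCoeff ω.f T T' * (v (ω.j0, T) * v (ω.j1, T')) =
      ∑ T : {T : Finset (Fin ℓ) // T.card ≤ b}, ∑ T' : {T : Finset (Fin ℓ) // T.card ≤ b},
        walshCoeff ω.f T T' * (p T * q T') := by
    refine Finset.sum_congr rfl fun T _ => Finset.sum_congr rfl fun T' _ => ?_
    simp only [hp, hq]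
    by_cases h0 : (T : Finset (Fin ℓ)) ⊆ ω.S0
    · by_cases h1 : (T' : Finset (Fin ℓ)) ⊆ ω.S1
      · rw [if_pos h0, if_pos h1]
      · rw [walshCoeff_eq_zero_right hω _ h1, zero_mul, zero_mul]
    · rw [walshCoeff_eq_zero_left hω h0, zero_mul, zero_mul]
  have hsq : ∀ (P : Prop) [Decidable P] (a : ℝ),
      (if P then a ^ 2 else 0) = (if P then a else 0) ^ 2 := by
    intro P _ a
    split_ifs <;> simp
  simp only [hsq]
  rw [hform]
  change |2 * _| ≤ ∑ T, p T ^ 2 + ∑ T, q T ^ 2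
  have hle : ∑ T : {T : Finset (Fin ℓ) // T.card ≤ b},
      ∑ T' : {T : Finset (Fin ℓ) // T.card ≤ b}, walshCoeff ω.f T T' ^ 2 ≤ 1 := by
    rw [← sum_walshCoeff_sq ω.f]
    rw [sum_subtype_card_le
      (g := fun T => ∑ T' : {T : Finset (Fin ℓ) // T.card ≤ b}, walshCoeff ω.f T T' ^ 2)]
    · refine Finset.sum_le_sum fun T _ => le_of_eq (sum_subtype_card_le
        (g := fun T' => walshCoeff ω.f T T' ^ 2) fun T' hT' => ?_)
      rw [walshCoeff_eq_zero_right hω]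
      · simp
      · intro h
        have := Finset.card_le_card h
        rw [hω.2.2.1] at this
        omega
    · intro T hT
      refine Finset.sum_eq_zero fun T' _ => ?_
      rw [walshCoeff_eq_zero_left hω]
      · simp
      · intro h
        have := Finset.card_le_card h
        rw [hω.2.1] at this
        omega
  set X := ∑ T, p T ^ 2 with hX
  set Y := ∑ T, q T ^ 2 with hY
  have hX0 : 0 ≤ X := Finset.sum_nonneg fun _ _ => sq_nonneg _
  have hY0 : 0 ≤ Y := Finset.sum_nonneg fun _ _ => sq_nonneg _
  have hcs : (∑ T : {T : Finset (Fin ℓ) // T.card ≤ b}, ∑ T' : {T : Finset (Fin ℓ) // T.card ≤ b},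
      walshCoeff ω.f T T' * (p T * q T')) ^ 2 ≤ X * Y := by
    have h := Finset.sum_mul_sq_le_sq_mul_sq Finset.univ
      (fun z : {T : Finset (Fin ℓ) // T.card ≤ b} × {T : Finset (Fin ℓ) // T.card ≤ b} =>
        walshCoeff ω.f z.1 z.2) (fun z => p z.1 * q z.2)
    simp only [Fintype.sum_prod_type, mul_pow] at h
    have hXY : ∑ T, ∑ T', p T ^ 2 * q T' ^ 2 = X * Y := by
      rw [hX, hY, Finset.sum_mul_sum]
    rw [hXY] at h
    exact h.trans (mul_le_of_le_one_left (mul_nonneg hX0 hY0) hle)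
  refine abs_le_of_sq_le_sq ?_ (add_nonneg hX0 hY0)
  nlinarith [sq_nonneg (X - Y)]

lemma DecTuple.Valid.posSemidef_support_add (hω : ω.Valid b) {e : ℝ} (he : |e| = 1) :
    (diagonal (ω.support (b := b)) + e • ω.observable b).PosSemidef := by
  refine .of_dotProduct_mulVec_nonneg ?_ fun v => ?_
  · rw [IsHermitian, conjTranspose_eq_transpose_of_trivial, transpose_add, transpose_smul,
      DecTuple.observable_isSymm, diagonal_transpose]
  · rw [star_trivial, add_mulVec, dotProduct_add, smul_mulVec, dotProduct_smul, smul_eq_mul]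
    have h1 : v ⬝ᵥ (diagonal (ω.support (b := b)) *ᵥ v) = ∑ x, ω.support x * v x ^ 2 := by
      simp only [dotProduct, mulVec_diagonal]
      exact Finset.sum_congr rfl fun x _ => by ring
    have h2 := hω.abs_observable_form_le v
    have h3 : |e * (v ⬝ᵥ (ω.observable b *ᵥ v))| = |v ⬝ᵥ (ω.observable b *ᵥ v)| := by
      rw [abs_mul, he, one_mul]
    have h4 := neg_abs_le (e * (v ⬝ᵥ (ω.observable b *ᵥ v)))
    rw [h1]
    linarith

lemma DecTuple.Valid.sum_support (hω : ω.Valid b) :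
    ∑ x : QueryIndex m ℓ b, ω.support x = 2 ^ (b + 1) := by
  have h := ω.support_form (b := b) fun _ => 1
  simp only [one_pow, mul_one] at h
  have hcount : ∀ S : Finset (Fin ℓ), S.card = b →
      ∑ T : {T : Finset (Fin ℓ) // T.card ≤ b},
        (if (T : Finset (Fin ℓ)) ⊆ S then (1 : ℝ) else 0) = 2 ^ b := by
    intro S hS
    rw [sum_subtype_card_le (g := fun T => if T ⊆ S then (1 : ℝ) else 0)]
    · rw [Finset.sum_ite, Finset.sum_const_zero, add_zero, Finset.sum_const, nsmul_eq_mul,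
        mul_one, Finset.filter_subset_univ, Finset.card_powerset, hS]
      norm_num
    · intro T hT
      rw [if_neg]
      intro h
      have := Finset.card_le_card h
      omega
  rw [h, hcount _ hω.2.1, hcount _ hω.2.2.1]
  ring

lemma DecTuple.Valid.observable_form_walsh (hω : ω.Valid b) (a : Fin m → Fin ℓ → Bool) :
    (fun x : QueryIndex m ℓ b => walsh x.2.1 (a x.1)) ⬝ᵥ
      (ω.observable b *ᵥ fun x => walsh x.2.1 (a x.1)) =
      2 * bitSign (ω.f (a ω.j0) (a ω.j1)) := by
  rw [DecTuple.observable_form, ← sum_walshCoeff_mul]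
  congr 1
  rw [sum_subtype_card_le
    (g := fun T => ∑ T' : {T : Finset (Fin ℓ) // T.card ≤ b},
      walshCoeff ω.f T T' * (walsh T (a ω.j0) * walsh T' (a ω.j1)))]
  · refine Finset.sum_congr rfl fun T _ => sum_subtype_card_le
      (g := fun T' => walshCoeff ω.f T T' * (walsh T (a ω.j0) * walsh T' (a ω.j1)))
      fun T' hT' => ?_
    rw [walshCoeff_eq_zero_right hω, zero_mul]
    intro h
    have := Finset.card_le_card h
    rw [hω.2.2.1] at this
    omega
  · intro T hT
    refine Finset.sum_eq_zero fun T' _ => ?_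
    rw [walshCoeff_eq_zero_left hω, zero_mul]
    intro h
    have := Finset.card_le_card h
    rw [hω.2.1] at this
    omega

end Observable

lemma one_sub_binEnt_mul_log_two {t : ℝ} (h0 : -1 < t) (h1 : t < 1) :
    (1 - binEnt ((1 + t) / 2)) * Real.log 2 =
      (Real.log (1 + t) + Real.log (1 - t)) / 2 +
        t * ((Real.log (1 + t) - Real.log (1 - t)) / 2) := by
  have h2 : Real.log 2 ≠ 0 := (Real.log_pos one_lt_two).ne'
  rw [binEnt, show 1 - (1 + t) / 2 = (1 - t) / 2 by ring, Real.logb, Real.logb,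
    Real.log_div (by linarith) two_ne_zero, Real.log_div (by linarith) two_ne_zero]
  field_simp
  ring

section SmoothDecoder

variable {n m ℓ b : ℕ} {c ε : ℝ} {C : (Fin n → Bool) → Fin m → Fin ℓ → Bool} {i : Fin n}
  {D : DecTuple m ℓ → ℝ}

lemma trace_smul_vecMulVec_mul {ι : Type*} [Fintype ι] (r : ℝ) (v : ι → ℝ)
    (M : Matrix ι ι ℝ) : trace ((r • vecMulVec v v) * M) = r * (v ⬝ᵥ (M *ᵥ v)) := by
  rw [smul_mul_assoc, trace_smul, vecMulVec_mul, trace_vecMulVec, smul_eq_mul,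
    dotProduct_mulVec, dotProduct_comm]

lemma IsSmoothDecoder.exists_pos (h : IsSmoothDecoder b c ε C i D) : ∃ ω, 0 < D ω := by
  by_contra! hD
  have := Finset.sum_nonpos fun ω (_ : ω ∈ Finset.univ) => hD ω
  rw [h.2.1] at this
  linarith

lemma IsSmoothDecoder.length_pos (h : IsSmoothDecoder b c ε C i D) : 0 < m :=
  let ⟨ω, _⟩ := h.exists_pos
  ω.j0.pos

lemma IsSmoothDecoder.smoothness_pos (h : IsSmoothDecoder b c ε C i D) : 0 < c := by
  obtain ⟨ω, hω⟩ := h.exists_pos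
  have hm : (0 : ℝ) < m := Nat.cast_pos.2 h.length_pos
  have hle : D ω ≤ c / m := (Finset.single_le_sum (fun ω' _ => h.1 ω')
    (by simp)).trans (h.2.2.2.2 ω.j0)
  have := hω.trans_le hle
  rwa [div_pos_iff_of_pos_right hm] at this

lemma IsSmoothDecoder.advantage_le (h : IsSmoothDecoder b c ε C i D) : ε ≤ 1 / 2 := by
  have h1 := h.2.2.2.1 fun _ => false
  have h2 := Finset.sum_le_univ_sum_of_nonneg (f := D) h.1 (s := Finset.univ.filter
    fun ω : DecTuple m ℓ => ω.f (C (fun _ => false) ω.j0) (C (fun _ => false) ω.j1) = false)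
  rw [h.2.1] at h2
  linarith

lemma IsSmoothDecoder.two_mul_le_sum (h : IsSmoothDecoder b c ε C i D) (x : Fin n → Bool) :
    2 * ε ≤ ∑ ω, D ω * (bitSign (x i) * bitSign (ω.f (C x ω.j0) (C x ω.j1))) := by
  have hsign : ∀ p q : Bool, bitSign p * bitSign q = 2 * (if q = p then 1 else 0) - 1 := by
    intro p q
    cases p <;> cases q <;> norm_num [bitSign]
  have h1 := h.2.2.2.1 x
  rw [Finset.sum_filter] at h1
  have h2 : ∑ ω, D ω * (bitSign (x i) * bitSign (ω.f (C x ω.j0) (C x ω.j1))) =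
      2 * (∑ ω, if ω.f (C x ω.j0) (C x ω.j1) = x i then D ω else 0) - ∑ ω, D ω := by
    rw [Finset.mul_sum, ← Finset.sum_sub_distrib]
    refine Finset.sum_congr rfl fun ω _ => ?_
    rw [hsign]
    split_ifs <;> ring
  rw [h2, h.2.1]
  linarith

/-- The mixture of the support projections, normalised to be at most the identity. -/
noncomputable def supportMatrix (b : ℕ) (c : ℝ) (D : DecTuple m ℓ → ℝ) :
    Matrix (QueryIndex m ℓ b) (QueryIndex m ℓ b) ℝ :=
  ∑ ω, (m / c * D ω) • diagonal (ω.support (b := b))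

/-- The mixture of the observables, normalised like `supportMatrix`. -/
noncomputable def observableMatrix (b : ℕ) (c : ℝ) (D : DecTuple m ℓ → ℝ) :
    Matrix (QueryIndex m ℓ b) (QueryIndex m ℓ b) ℝ :=
  ∑ ω, (m / c * D ω) • ω.observable b

lemma IsSmoothDecoder.posSemidef_add (h : IsSmoothDecoder b c ε C i D) {e : ℝ}
    (he : |e| = 1) :
    (supportMatrix b c D + e • observableMatrix b c D).PosSemidef := by
  rw [supportMatrix, observableMatrix, Finset.smul_sum, ← Finset.sum_add_distrib]
  refine posSemidef_sum _ fun ω _ => ?_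
  rw [smul_comm, ← smul_add]
  by_cases hω : D ω = 0
  · rw [hω, mul_zero, zero_smul]
    exact PosSemidef.zero
  · have hm : (0 : ℝ) < m := Nat.cast_pos.2 h.length_pos
    exact ((h.2.2.1 ω hω).posSemidef_support_add he).smul
      (mul_nonneg (div_nonneg hm.le h.smoothness_pos.le) (h.1 ω))

lemma DecTuple.Valid.support_le {ω : DecTuple m ℓ} (hω : ω.Valid b) (x : QueryIndex m ℓ b) :
    ω.support x ≤ if ω.j0 = x.1 ∨ ω.j1 = x.1 then 1 else 0 := by
  have hne := hω.1
  rw [DecTuple.support]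
  by_cases h0 : x.1 = ω.j0
  · have h1 : x.1 ≠ ω.j1 := fun h1 => hne (h0.symm.trans h1)
    rw [if_pos h0, if_neg h1, if_pos (Or.inl h0.symm), add_zero]
    split_ifs <;> norm_num
  · by_cases h1 : x.1 = ω.j1
    · rw [if_neg h0, if_pos h1, if_pos (Or.inr h1.symm), zero_add]
      split_ifs <;> norm_num
    · rw [if_neg h0, if_neg h1, add_zero]
      split_ifs <;> norm_num

lemma IsSmoothDecoder.posSemidef_one_sub (h : IsSmoothDecoder b c ε C i D) :
    (1 - supportMatrix b c D).PosSemidef := by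
  have hm : (0 : ℝ) < m := Nat.cast_pos.2 h.length_pos
  have hc := h.smoothness_pos
  have hdiag : 1 - supportMatrix b c D =
      diagonal fun x => 1 - ∑ ω, m / c * D ω * ω.support (b := b) x := by
    ext x y
    by_cases hxy : x = y
    · subst hxy
      simp [supportMatrix, Matrix.sum_apply]
    · simp [supportMatrix, Matrix.sum_apply, hxy]
  rw [hdiag, posSemidef_diagonal_iff]
  intro x
  have hsum : ∑ ω, D ω * ω.support (b := b) x ≤ c / m := by
    refine le_trans ?_ (h.2.2.2.2 x.1)
    rw [Finset.sum_filter]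
    refine Finset.sum_le_sum fun ω _ => ?_
    by_cases hω : D ω = 0
    · simp [hω]
    · have := mul_le_mul_of_nonneg_left ((h.2.2.1 ω hω).support_le x) (h.1 ω)
      simpa using this
  have : ∑ ω, m / c * D ω * ω.support (b := b) x ≤ 1 := by
    calc _ = m / c * ∑ ω, D ω * ω.support (b := b) x := by
          rw [Finset.mul_sum]
          exact Finset.sum_congr rfl fun _ _ => mul_assoc _ _ _
      _ ≤ m / c * (c / m) := mul_le_mul_of_nonneg_left hsum (by positivity)
      _ = 1 := by field_simp
  exact sub_nonneg.2 this

/-- The vector of all parities of at most `b` bits of each position of a code word. -/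
def parityVec (b : ℕ) (a : Fin m → Fin ℓ → Bool) (x : QueryIndex m ℓ b) : ℝ :=
  walsh x.2.1 (a x.1)

/-- The normalised projection onto `parityVec`. -/
noncomputable def parityState (b : ℕ) (a : Fin m → Fin ℓ → Bool) :
    Matrix (QueryIndex m ℓ b) (QueryIndex m ℓ b) ℝ :=
  (Fintype.card (QueryIndex m ℓ b) : ℝ)⁻¹ • vecMulVec (parityVec b a) (parityVec b a)

lemma posSemidef_parityState (a : Fin m → Fin ℓ → Bool) : (parityState b a).PosSemidef := by
  have h := posSemidef_vecMulVec_self_star (parityVec b a)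
  rw [star_trivial] at h
  exact h.smul (by positivity)

lemma trace_parityState [Nonempty (QueryIndex m ℓ b)] (a : Fin m → Fin ℓ → Bool) :
    trace (parityState b a) = 1 := by
  rw [parityState, trace_smul, trace_vecMulVec, smul_eq_mul]
  simp only [dotProduct, parityVec, walsh_mul_self, Finset.sum_const, Finset.card_univ, nsmul_one]
  exact inv_mul_cancel₀ (Nat.cast_ne_zero.2 Fintype.card_ne_zero)

lemma IsSmoothDecoder.trace_parityState_mul_supportMatrix (h : IsSmoothDecoder b c ε C i D)
    (a : Fin m → Fin ℓ → Bool) :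
    trace (parityState b a * supportMatrix b c D) =
      (Fintype.card (QueryIndex m ℓ b) : ℝ)⁻¹ * (m / c * 2 ^ (b + 1)) := by
  rw [parityState, trace_smul_vecMulVec_mul]
  congr 1
  have hterm : ∀ ω : DecTuple m ℓ, parityVec b a ⬝ᵥ
      (((m / c * D ω) • diagonal (ω.support (b := b))) *ᵥ parityVec b a) =
      m / c * 2 ^ (b + 1) * D ω := by
    intro ω
    by_cases hω : D ω = 0
    · simp [hω]
    · rw [smul_mulVec, dotProduct_smul, smul_eq_mul]
      have : parityVec b a ⬝ᵥ (diagonal (ω.support (b := b)) *ᵥ parityVec b a) =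
          2 ^ (b + 1) := by
        rw [← (h.2.2.1 ω hω).sum_support]
        simp only [dotProduct, mulVec_diagonal]
        refine Finset.sum_congr rfl fun x _ => ?_
        rw [mul_left_comm, parityVec, walsh_mul_self, mul_one]
      rw [this]
      ring
  rw [supportMatrix, sum_mulVec, dotProduct_sum]
  simp only [hterm]
  rw [← Finset.mul_sum, h.2.1, mul_one]

lemma IsSmoothDecoder.le_trace_parityState_mul_observableMatrix
    (h : IsSmoothDecoder b c ε C i D) (x : Fin n → Bool) :
    (Fintype.card (QueryIndex m ℓ b) : ℝ)⁻¹ * (m / c * (4 * ε)) ≤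
      bitSign (x i) * trace (parityState b (C x) * observableMatrix b c D) := by
  have hm : (0 : ℝ) < m := Nat.cast_pos.2 h.length_pos
  have hc := h.smoothness_pos
  have hterm : ∀ ω : DecTuple m ℓ, parityVec b (C x) ⬝ᵥ
      (((m / c * D ω) • ω.observable b) *ᵥ parityVec b (C x)) =
      m / c * D ω * (2 * bitSign (ω.f (C x ω.j0) (C x ω.j1))) := by
    intro ω
    by_cases hω : D ω = 0
    · simp [hω]
    · rw [smul_mulVec, dotProduct_smul, smul_eq_mul]
      exact congrArg _ ((h.2.2.1 ω hω).observable_form_walsh (C x))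
  rw [parityState, trace_smul_vecMulVec_mul, observableMatrix, sum_mulVec, dotProduct_sum,
    mul_left_comm (bitSign _)]
  simp only [hterm]
  have hsum : bitSign (x i) * ∑ ω, m / c * D ω *
      (2 * bitSign (ω.f (C x ω.j0) (C x ω.j1))) =
      m / c * (2 * ∑ ω, D ω * (bitSign (x i) * bitSign (ω.f (C x ω.j0) (C x ω.j1)))) := by
    simp only [Finset.mul_sum]
    exact Finset.sum_congr rfl fun _ _ => by ring
  rw [hsum]
  refine mul_le_mul_of_nonneg_left (mul_le_mul_of_nonneg_left ?_ (by positivity)) (by positivity)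
  linarith [h.two_mul_le_sum x]

end SmoothDecoder

end Auxiliary

theorem stmt11 (n m ℓ b : ℕ) (c ε : ℝ) (hn : 1 ≤ n) (hε : 0 < ε)
    (C : (Fin n → Bool) → Fin m → Fin ℓ → Bool)
    (h : IsSmoothCode n m ℓ b c ε C)
    (u : ℕ) (hu : u = ∑ i ∈ Finset.range (b + 1), ℓ.choose i)
    (d : ℝ) (hd : d = (1 - binEnt (1 / 2 + ε / 2 ^ (b + 1))) * 2 ^ (b + 1) / (c * u)) :
    (2 : ℝ) ^ (d * n - Real.logb 2 u) ≤ m := by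
  choose D hD using h
  have hm := (hD ⟨0, hn⟩).length_pos
  have hm' : (0 : ℝ) < m := Nat.cast_pos.2 hm
  have hc := (hD ⟨0, hn⟩).smoothness_pos
  have hε2 := (hD ⟨0, hn⟩).advantage_le
  have hcard : Fintype.card (QueryIndex m ℓ b) = m * u := by rw [card_queryIndex, hu]
  have : Nonempty (QueryIndex m ℓ b) := ⟨⟨0, hm⟩, ⟨∅, by simp⟩⟩
  have hu0 : 0 < u := by
    have := Fintype.card_pos (α := QueryIndex m ℓ b)
    rw [hcard] at this
    exact Nat.pos_of_mul_pos_left this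
  have hu' : (0 : ℝ) < u := Nat.cast_pos.2 hu0
  set t : ℝ := ε / 2 ^ b with ht
  have ht0 : 0 < t := by positivity
  have ht1 : t < 1 := by
    have : t ≤ ε := div_le_self hε.le (one_le_pow₀ one_le_two)
    linarith
  set α := (Real.log (1 + t) + Real.log (1 - t)) / 2 with hα
  set β := (Real.log (1 + t) - Real.log (1 - t)) / 2 with hβ
  have hβ0 : 0 ≤ β := by
    have := Real.log_le_log (by linarith) (show 1 - t ≤ 1 + t by linarith)
    linarith
  have hent : (1 - binEnt (1 / 2 + ε / 2 ^ (b + 1))) * Real.log 2 = α + t * β := by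
    rw [← one_sub_binEnt_mul_log_two (by linarith) ht1, ht]
    congr 3
    rw [pow_succ]
    field_simp
  have hmain := mul_le_log_card_of_observables (δ := 2 ^ (b + 1) / (c * u) * (α + t * β))
    (abs_lt.2 ⟨by linarith, ht1⟩) n (fun x => parityState b (C x))
    (fun x => posSemidef_parityState (C x)) (fun x => trace_parityState (C x))
    (fun i => supportMatrix b c (D i)) (fun i => observableMatrix b c (D i))
    (fun i => by simpa using (hD i).posSemidef_add (e := 1) (by simp))
    (fun i => by simpa [sub_eq_add_neg] using (hD i).posSemidef_add (e := -1) (by simp))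
    (fun i => (hD i).posSemidef_one_sub) (fun x i => by
      have h1 := (hD i).le_trace_parityState_mul_observableMatrix x
      rw [(hD i).trace_parityState_mul_supportMatrix, hcard, Nat.cast_mul]
      rw [hcard, Nat.cast_mul] at h1
      have h2 := mul_le_mul_of_nonneg_left h1 hβ0
      have h3 : ((m : ℝ) * u)⁻¹ * (m / c * 2 ^ (b + 1)) = 2 ^ (b + 1) / (c * u) := by
        field_simp
      have h4 : ((m : ℝ) * u)⁻¹ * (m / c * (4 * ε)) = 2 * (2 ^ (b + 1) / (c * u) * t) := by
        rw [ht, pow_succ]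
        field_simp
        norm_num
      rw [h4] at h2
      rw [h3, ← hα, ← hβ]
      have h5 : 0 ≤ β * (2 ^ (b + 1) / (c * u) * t) := by positivity
      linarith)
  have hlog2 := Real.log_pos one_lt_two
  rw [hcard, Nat.cast_mul, Real.log_mul hm'.ne' hu'.ne'] at hmain
  rw [← Real.le_logb_iff_rpow_le one_lt_two hm', sub_le_iff_le_add, Real.logb, Real.logb,
    ← add_div, le_div_iff₀ hlog2]
  calc d * n * Real.log 2 = n * (2 ^ (b + 1) / (c * u) * (α + t * β)) := by
        rw [hd, ← hent]
        ring
    _ ≤ _ := hmain
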